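/- Let G = (V, E) be a finite simple graph. Suppose that for every independent set F of G that is not a maximal independent set (including F = ∅), the induced subgraph H = G \ N_G[F] satisfies at least one of the following: (i) H has no chordless even cycle; (ii) H has a simplicial vertex, i.e., a vertex z ∈ V(H) such that N_H[z] induces a complete graph; (iii) for some t ≥ 2, H contains a chordless (2t+1)-cycle having t vertices which are independent in H and each of degree 2 in H. Then G is sequentially S_2 over any field k. -/

import Mathlib

open MvPolynomial

namespace SeqSr

/-! ### Abstract simplicial complexes -/

/-- An abstract simplicial complex on the vertex set `V`, viewed as a set of finite
subsets of `V` (its faces) closed under taking subsets. -/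
def IsComplex {V : Type*} (Δ : Set (Finset V)) : Prop :=
  ∀ F ∈ Δ, ∀ G : Finset V, G ⊆ F → G ∈ Δ

/-- `Δ` is `(d-1)`-dimensional: every face has at most `d` vertices and
some face has exactly `d` vertices. -/
def HasDim {V : Type*} (Δ : Set (Finset V)) (d : ℕ) : Prop :=
  (∀ F ∈ Δ, F.card ≤ d) ∧ ∃ F ∈ Δ, F.card = d

/-- A facet is a maximal face. -/
def IsFacet {V : Type*} (Δ : Set (Finset V)) (F : Finset V) : Prop :=
  F ∈ Δ ∧ ∀ G ∈ Δ, F ⊆ G → F = G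

/-- A simplicial complex is pure if all facets have the same number of vertices. -/
def IsPure {V : Type*} (Δ : Set (Finset V)) : Prop :=
  ∀ F G : Finset V, IsFacet Δ F → IsFacet Δ G → F.card = G.card

/-- The link of a face `F` of `Δ`:
`lk_Δ F = {G : F ∩ G = ∅ and F ∪ G ∈ Δ}`. -/
def link {V : Type*} [DecidableEq V] (Δ : Set (Finset V)) (F : Finset V) :
    Set (Finset V) :=
  {G | F ∩ G = ∅ ∧ F ∪ G ∈ Δ}

/-- The `i`-skeleton of `Δ`: all faces of dimension at most `i`
(i.e. with at most `i + 1` vertices). -/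
def skeleton {V : Type*} (Δ : Set (Finset V)) (i : ℕ) : Set (Finset V) :=
  {F ∈ Δ | F.card ≤ i + 1}

/-- The pure `i`-skeleton of `Δ`: the subcomplex generated by the `i`-dimensional
faces of `Δ` (here `i : ℤ`, so that `i = -1` makes sense). -/
def pureSkeleton {V : Type*} (Δ : Set (Finset V)) (i : ℤ) : Set (Finset V) :=
  {F | ∃ G ∈ Δ, (G.card : ℤ) = i + 1 ∧ F ⊆ G}

/-- A simplicial complex is connected if any two of its vertices can be joined by a
path of `1`-dimensional faces. -/
def IsConnectedComplex {V : Type*} [DecidableEq V] (Δ : Set (Finset V)) : Prop :=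
  ∀ x y : V, {x} ∈ Δ → {y} ∈ Δ →
    Relation.ReflTransGen (fun a b : V => ({a, b} : Finset V) ∈ Δ) x y

/-! ### Stanley-Reisner rings -/

/-- The Stanley-Reisner ideal of `Δ` in the polynomial ring `k[x_v : v ∈ V]`:
the ideal generated by the squarefree monomials corresponding to non-faces of `Δ`. -/
noncomputable def srIdeal (k : Type*) [Field k] {V : Type*} (Δ : Set (Finset V)) :
    Ideal (MvPolynomial V k) :=
  Ideal.span {m | ∃ F : Finset V, F ∉ Δ ∧ m = ∏ i ∈ F, X i}

/-! ### Depth, dimension and Serre's condition for modules -/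

/-- The depth of `M` with respect to the ideal `I`: the supremum of the lengths of
`M`-regular sequences consisting of elements of `I`.  (For a finitely generated
module over a Noetherian local ring, taking `I` to be the maximal ideal recovers the
usual depth.) -/
noncomputable def depthIn (A : Type*) [CommRing A] (I : Ideal A) (M : Type*)
    [AddCommGroup M] [Module A M] : ℕ∞ :=
  sSup {n : ℕ∞ | ∃ rs : List A, (∀ x ∈ rs, x ∈ I) ∧
    RingTheory.Sequence.IsRegular M rs ∧ (rs.length : ℕ∞) = n}

/-- The (Krull) dimension of a module `M` over `A`: the Krull dimension of the ring
`A` modulo the annihilator of `M`. -/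
noncomputable def mDim (A : Type*) [CommRing A] (M : Type*)
    [AddCommGroup M] [Module A M] : WithBot ℕ∞ :=
  ringKrullDim (A ⧸ Module.annihilator A M)

/-- Serre's condition `S_r` for a module `M` over `A`: for every prime ideal `p`,
`depth M_p ≥ min (r, dim M_p)`. -/
def IsSerreMod (r : ℕ) (A : Type*) [CommRing A] (M : Type*)
    [AddCommGroup M] [Module A M] : Prop :=
  ∀ (p : Ideal A) [p.IsPrime],
    min ((r : ℕ∞) : WithBot ℕ∞)
        (mDim (Localization p.primeCompl) (LocalizedModule p.primeCompl M)) ≤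
      ((depthIn (Localization p.primeCompl)
          (Ideal.map (algebraMap A (Localization p.primeCompl)) p)
          (LocalizedModule p.primeCompl M) : ℕ∞) : WithBot ℕ∞)

/-- A module `M` over `A` is Cohen-Macaulay if `depth M_p ≥ dim M_p` for every
prime ideal `p` (the reverse inequality being automatic). -/
def IsCMMod (A : Type*) [CommRing A] (M : Type*) [AddCommGroup M] [Module A M] : Prop :=
  ∀ (p : Ideal A) [p.IsPrime],
    mDim (Localization p.primeCompl) (LocalizedModule p.primeCompl M) ≤
      ((depthIn (Localization p.primeCompl)
          (Ideal.map (algebraMap A (Localization p.primeCompl)) p)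
          (LocalizedModule p.primeCompl M) : ℕ∞) : WithBot ℕ∞)

/-- `Δ` satisfies Serre's condition `S_r` over `k` if its Stanley-Reisner ring
`k[Δ]` does, as a module over the polynomial ring. -/
def IsSerreComplex (k : Type*) [Field k] {V : Type*} (Δ : Set (Finset V)) (r : ℕ) :
    Prop :=
  IsSerreMod r (MvPolynomial V k) (MvPolynomial V k ⧸ srIdeal k Δ)

/-! ### Sequentially `S_r` and sequentially Cohen-Macaulay complexes -/

/-- A homogeneous ideal of the polynomial ring (with respect to the standard
grading): an ideal containing all homogeneous components of its elements. -/
def IsHomogeneousIdeal (k : Type*) [Field k] {V : Type*}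
    (J : Ideal (MvPolynomial V k)) : Prop :=
  ∀ f ∈ J, ∀ i : ℕ, homogeneousComponent i f ∈ J

/-- For ideals `J ⊆ J'` of `A`, the subquotient `J'/J` as an `A`-module. -/
abbrev subquot {A : Type*} [CommRing A] (J J' : Ideal A) : Type _ :=
  ↥J' ⧸ Submodule.comap J'.subtype J

/-- `Δ` is sequentially `S_r` over `k`: there is a finite filtration
`0 = M_0 ⊂ M_1 ⊂ ⋯ ⊂ M_t = k[Δ]` of `k[Δ]` by graded submodules such that each
quotient `M_i/M_{i-1}` satisfies Serre's condition `S_r` and the (Krull) dimensions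
of the quotients are strictly increasing.  Since `k[Δ]` is a cyclic module generated
in degree `0`, its graded submodules are exactly the images of homogeneous ideals
`J ⊇ I_Δ`, and `M_i/M_{i-1} = J_i/J_{i-1}`; we state the definition this way. -/
def IsSeqSerre (k : Type*) [Field k] {V : Type*} (Δ : Set (Finset V)) (r : ℕ) : Prop :=
  ∃ (t : ℕ) (J : ℕ → Ideal (MvPolynomial V k)),
    J 0 = srIdeal k Δ ∧ J t = ⊤ ∧
    (∀ i ≤ t, IsHomogeneousIdeal k (J i)) ∧
    (∀ i < t, J i < J (i + 1)) ∧
    (∀ i < t, IsSerreMod r (MvPolynomial V k) (subquot (J i) (J (i + 1)))) ∧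
    (∀ i : ℕ, i + 2 ≤ t →
      mDim (MvPolynomial V k) (subquot (J i) (J (i + 1))) <
        mDim (MvPolynomial V k) (subquot (J (i + 1)) (J (i + 2))))

/-- `Δ` is sequentially Cohen-Macaulay over `k`: there is a finite filtration
`0 = M_0 ⊂ M_1 ⊂ ⋯ ⊂ M_t = k[Δ]` by graded submodules with Cohen-Macaulay
quotients of strictly increasing dimensions. -/
def IsSeqCM (k : Type*) [Field k] {V : Type*} (Δ : Set (Finset V)) : Prop :=
  ∃ (t : ℕ) (J : ℕ → Ideal (MvPolynomial V k)),
    J 0 = srIdeal k Δ ∧ J t = ⊤ ∧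
    (∀ i ≤ t, IsHomogeneousIdeal k (J i)) ∧
    (∀ i < t, J i < J (i + 1)) ∧
    (∀ i < t, IsCMMod (MvPolynomial V k) (subquot (J i) (J (i + 1)))) ∧
    (∀ i : ℕ, i + 2 ≤ t →
      mDim (MvPolynomial V k) (subquot (J i) (J (i + 1))) <
        mDim (MvPolynomial V k) (subquot (J (i + 1)) (J (i + 2))))

/-! ### Graphs -/

/-- The independence complex of a graph `G`: faces are the independent sets. -/
def indepComplex {V : Type*} (G : SimpleGraph V) : Set (Finset V) :=
  {F | ∀ x ∈ F, ∀ y ∈ F, ¬ G.Adj x y}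

/-- `G` has a chordless (induced) cycle of length `m`: there is an injective map
`f : ZMod m → V` such that two vertices `f i`, `f j` are adjacent in `G` exactly
when `i` and `j` are consecutive modulo `m`. -/
def HasChordlessCycle {V : Type*} (G : SimpleGraph V) (m : ℕ) : Prop :=
  3 ≤ m ∧ ∃ f : ZMod m → V, Function.Injective f ∧
    ∀ i j : ZMod m, G.Adj (f i) (f j) ↔ (j = i + 1 ∨ i = j + 1)

/-- `G` has a simplicial vertex: a vertex `z` whose closed neighborhood induces a
complete graph. -/
def HasSimplicialVertex {V : Type*} (G : SimpleGraph V) : Prop :=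
  ∃ z : V, ∀ u v : V, G.Adj z u → G.Adj z v → u ≠ v → G.Adj u v

/-- For some `t ≥ 2`, `G` has a chordless `(2t+1)`-cycle having `t` vertices which
are independent in `G` and each of degree `2` in `G`. -/
def HasGoodOddCycle {V : Type*} (G : SimpleGraph V) : Prop :=
  ∃ t : ℕ, 2 ≤ t ∧ ∃ f : ZMod (2 * t + 1) → V, Function.Injective f ∧
    (∀ i j : ZMod (2 * t + 1), G.Adj (f i) (f j) ↔ (j = i + 1 ∨ i = j + 1)) ∧
    ∃ T : Finset (ZMod (2 * t + 1)), T.card = t ∧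
      (∀ i ∈ T, ∀ j ∈ T, i ≠ j → ¬ G.Adj (f i) (f j)) ∧
      (∀ i ∈ T, ∀ u : V, G.Adj (f i) u → u = f (i + 1) ∨ u = f (i - 1))

/-! ### Coordinate projections and the ideals of faces -/

/-- The `k`-algebra endomorphism of `k[x_v : v ∈ V]` which fixes `x_v` for `v ∈ F` and kills
the other variables. -/
noncomputable def proj (k : Type*) [Field k] {V : Type*} [DecidableEq V] (F : Finset V) :
    MvPolynomial V k →ₐ[k] MvPolynomial V k :=
  aeval fun v => if v ∈ F then X v else 0

/-- The prime ideal generated by the variables outside `F`. -/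
noncomputable def faceIdeal (k : Type*) [Field k] {V : Type*} [DecidableEq V] (F : Finset V) :
    Ideal (MvPolynomial V k) :=
  RingHom.ker (proj k F)

/-- The intersection of the ideals of the faces in a family. -/
noncomputable def famIdeal (k : Type*) [Field k] {V : Type*} [DecidableEq V]
    (P : Finset V → Prop) : Ideal (MvPolynomial V k) :=
  ⨅ F, ⨅ _ : P F, faceIdeal k F

section Proj

variable {k : Type*} [Field k] {V : Type*} [DecidableEq V]

lemma proj_monomial (F : Finset V) (b : V →₀ ℕ) (c : k) :
    proj k F (monomial b c) = if b.support ⊆ F then monomial b c else 0 := by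
  rw [proj, aeval_monomial, Finsupp.prod]
  split_ifs with h
  · rw [Finset.prod_congr rfl (fun v hv => by rw [if_pos (h hv)]), monomial_eq]
    rfl
  · obtain ⟨v, hv, hvF⟩ := Finset.not_subset.mp h
    rw [Finset.prod_eq_zero hv, mul_zero]
    rw [if_neg hvF, zero_pow (Finsupp.mem_support_iff.mp hv)]

lemma coeff_proj (F : Finset V) (a : V →₀ ℕ) (f : MvPolynomial V k) :
    coeff a (proj k F f) = if a.support ⊆ F then coeff a f else 0 := by
  induction f using MvPolynomial.induction_on' with
  | monomial b c =>
    rw [proj_monomial]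
    by_cases hab : b = a
    · subst hab; split_ifs <;> simp
    · split_ifs <;> simp [coeff_monomial, hab]
  | add p q hp hq =>
    rw [map_add, coeff_add, hp, hq, coeff_add]
    split_ifs <;> simp

lemma proj_proj_of_subset {F F' : Finset V} (h : F ⊆ F') (f : MvPolynomial V k) :
    proj k F (proj k F' f) = proj k F f := by
  ext a
  simp only [coeff_proj]
  split_ifs with h1 h2
  · rfl
  · exact absurd (h1.trans h) h2
  · rfl

lemma proj_X_of_mem {F : Finset V} {v : V} (h : v ∈ F) : proj k F (X v) = X v := by
  simp [proj, h]

lemma proj_X_of_notMem {F : Finset V} {v : V} (h : v ∉ F) : proj k F (X v) = 0 := by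
  simp [proj, h]

lemma mem_faceIdeal {F : Finset V} {f : MvPolynomial V k} :
    f ∈ faceIdeal k F ↔ proj k F f = 0 := Iff.rfl

lemma mem_faceIdeal_iff_coeff {F : Finset V} {f : MvPolynomial V k} :
    f ∈ faceIdeal k F ↔ ∀ a : V →₀ ℕ, a.support ⊆ F → coeff a f = 0 := by
  rw [mem_faceIdeal, MvPolynomial.ext_iff]
  simp only [coeff_proj, coeff_zero]
  exact ⟨fun h a ha => by simpa [ha] using h a, fun h a => by
    split_ifs with ha
    · exact h a ha
    · rfl⟩

instance faceIdeal_isPrime (F : Finset V) : (faceIdeal k F).IsPrime := by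
  unfold faceIdeal
  exact RingHom.ker_isPrime _

lemma X_mem_faceIdeal {F : Finset V} {v : V} : X v ∈ faceIdeal k F ↔ v ∉ F := by
  rw [mem_faceIdeal]
  constructor
  · intro h hv
    rw [proj_X_of_mem hv] at h
    exact X_ne_zero v h
  · exact proj_X_of_notMem

lemma faceIdeal_antitone {F F' : Finset V} (h : F ⊆ F') : faceIdeal k F' ≤ faceIdeal k F := by
  intro f hf
  rw [mem_faceIdeal] at *
  rw [← proj_proj_of_subset h, hf, map_zero]

lemma mem_famIdeal {P : Finset V → Prop} {f : MvPolynomial V k} :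
    f ∈ famIdeal k P ↔ ∀ F, P F → proj k F f = 0 := by
  simp [famIdeal, mem_faceIdeal]

lemma mem_famIdeal_iff_coeff {P : Finset V → Prop} {f : MvPolynomial V k} :
    f ∈ famIdeal k P ↔ ∀ F, P F → ∀ a : V →₀ ℕ, a.support ⊆ F → coeff a f = 0 := by
  rw [mem_famIdeal]
  exact forall₂_congr fun F _ => mem_faceIdeal_iff_coeff

lemma isHomogeneousIdeal_famIdeal (P : Finset V → Prop) :
    IsHomogeneousIdeal k (famIdeal k P) := by
  intro f hf i
  rw [mem_famIdeal_iff_coeff] at *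
  intro F hF a ha
  rw [coeff_homogeneousComponent, hf F hF a ha, ite_self]

lemma sub_proj_mem_span (F : Finset V) (f : MvPolynomial V k) :
    f - proj k F f ∈ Ideal.span (X '' {v : V | v ∉ F}) := by
  rw [mem_ideal_span_X_image]
  intro a ha
  rw [mem_support_iff, coeff_sub, coeff_proj] at ha
  by_cases h : a.support ⊆ F
  · simp [h] at ha
  · obtain ⟨v, hv, hvF⟩ := Finset.not_subset.mp h
    exact ⟨v, hvF, Finsupp.mem_support_iff.mp hv⟩

lemma faceIdeal_eq_span (F : Finset V) :
    faceIdeal k F = Ideal.span (X '' {v : V | v ∉ F}) := by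
  apply le_antisymm
  · intro f hf
    have := sub_proj_mem_span F f
    rwa [mem_faceIdeal.mp hf, sub_zero] at this
  · rw [Ideal.span_le]
    rintro _ ⟨v, hv, rfl⟩
    exact X_mem_faceIdeal.mpr hv

end Proj

/-! ### Heights of the ideals of faces -/

section Height

variable {k : Type*} [Field k] {V : Type*} [DecidableEq V] [Fintype V]

lemma card_compl_le_height_faceIdeal (F : Finset V) :
    ((Fᶜ.card : ℕ) : ℕ∞) ≤ (faceIdeal k F).height := by
  induction hn : Fᶜ.card generalizing F with
  | zero => simp
  | succ n ih =>
    obtain ⟨v, hv⟩ : Fᶜ.Nonempty := Finset.card_pos.mp (by omega)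
    rw [Finset.mem_compl] at hv
    have h1 := ih (insert v F) (by
      have := Finset.card_insert_of_notMem hv
      rw [Finset.card_compl] at *
      omega)
    have hlt : faceIdeal k (insert v F) < faceIdeal k F := by
      refine lt_of_le_of_ne (faceIdeal_antitone (Finset.subset_insert v F)) fun he => ?_
      have : (X v : MvPolynomial V k) ∈ faceIdeal k F := X_mem_faceIdeal.mpr hv
      rw [← he, X_mem_faceIdeal] at this
      exact this (Finset.mem_insert_self v F)
    push_cast
    exact (add_le_add_left h1 1).trans (Ideal.height_add_one_le_of_lt_of_isPrime hlt)

/-- A prime ideal generated by the variables outside `F` and a further polynomial has height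
at most one more than the number of variables outside `F`. -/
lemma height_le_of_eq_span_insert {F : Finset V} (g : MvPolynomial V k)
    {Q : Ideal (MvPolynomial V k)} [Q.IsPrime]
    (hQ : Q = Ideal.span (insert g (X '' {v : V | v ∉ F}))) :
    Q.height ≤ ((Fᶜ.card + 1 : ℕ) : ℕ∞) := by
  classical
  have h2 : Q ∈ (Ideal.span ((insert g (Fᶜ.image X) : Finset (MvPolynomial V k)) :
      Set (MvPolynomial V k))).minimalPrimes := by
    have : Q = Ideal.span ((insert g (Fᶜ.image X) : Finset (MvPolynomial V k)) :
        Set (MvPolynomial V k)) := by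
      rw [hQ]; congr 1; ext; simp
    rw [← this, Ideal.minimalPrimes_eq_subsingleton_self]
    rfl
  refine (Ideal.height_le_card_of_mem_minimalPrimes_span_finset h2).trans ?_
  exact_mod_cast (Finset.card_insert_le _ _).trans (Nat.succ_le_succ Finset.card_image_le)

lemma height_faceIdeal_le (F : Finset V) :
    (faceIdeal k F).height ≤ ((Fᶜ.card : ℕ) : ℕ∞) := by
  classical
  have h2 : faceIdeal k F ∈ (Ideal.span ((Fᶜ.image X : Finset (MvPolynomial V k)) :
      Set (MvPolynomial V k))).minimalPrimes := by
    have : faceIdeal k F = Ideal.span ((Fᶜ.image X : Finset (MvPolynomial V k)) :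
        Set (MvPolynomial V k)) := by
      rw [faceIdeal_eq_span]; congr 1; ext; simp
    rw [← this, Ideal.minimalPrimes_eq_subsingleton_self]
    rfl
  refine (Ideal.height_le_card_of_mem_minimalPrimes_span_finset h2).trans ?_
  exact_mod_cast Finset.card_image_le

/-- If every prime containing `B` has height at least `N`, then
`dim A / B + N ≤ dim A`. -/
lemma add_le_ringKrullDim_of_le_ringKrullDim_quotient {A : Type*} [CommRing A] {B : Ideal A}
    {N : ℕ} (hB : ∀ q : Ideal A, q.IsPrime → B ≤ q → (N : ℕ∞) ≤ q.height) {l : ℕ}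
    (hl : (l : WithBot ℕ∞) ≤ ringKrullDim (A ⧸ B)) :
    ((N + l : ℕ) : WithBot ℕ∞) ≤ ringKrullDim A := by
  obtain ⟨s, hs⟩ := Order.le_krullDim_iff.mp hl
  let q : Fin (s.length + 1) → Ideal A := fun i =>
    Ideal.comap (Ideal.Quotient.mk B) (s i).asIdeal
  have key : ∀ i : ℕ, ∀ h : i < s.length + 1, ((N + i : ℕ) : ℕ∞) ≤ (q ⟨i, h⟩).height := by
    intro i
    induction i with
    | zero =>
      intro h
      refine hB _ (Ideal.comap_isPrime _ _) fun b hb => ?_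
      have : Ideal.Quotient.mk B b = 0 := Ideal.Quotient.eq_zero_iff_mem.mpr hb
      simp [q, Ideal.mem_comap, this]
    | succ i ih =>
      intro h
      have hlt : q ⟨i, by omega⟩ < q ⟨i + 1, h⟩ := by
        have h1 : s ⟨i, by omega⟩ < s ⟨i + 1, h⟩ := s.strictMono (by simp)
        refine lt_of_le_of_ne (Ideal.comap_mono h1.le) fun he => h1.ne ?_
        exact PrimeSpectrum.ext (Ideal.comap_injective_of_surjective _
          Ideal.Quotient.mk_surjective he)
      have : (q ⟨i, by omega⟩).IsPrime := Ideal.comap_isPrime _ _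
      have : (q ⟨i + 1, h⟩).IsPrime := Ideal.comap_isPrime _ _
      have := (add_le_add_left (ih _) 1).trans
        (Ideal.height_add_one_le_of_lt_of_isPrime hlt)
      refine le_trans (le_of_eq ?_) this
      push_cast; ring
  have hp : (q ⟨s.length, by omega⟩).IsPrime := Ideal.comap_isPrime _ _
  have h1 := key s.length (by omega)
  rw [← hs]
  refine le_trans ?_ (Ideal.height_le_ringKrullDim_of_isPrime (I := q ⟨s.length, _⟩))
  exact_mod_cast h1

/-- A prime containing the intersection of the ideals of a family of `d`-element sets contains
one of them. -/
lemma exists_faceIdeal_le {P : Finset V → Prop} {q : Ideal (MvPolynomial V k)} (hq : q.IsPrime)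
    (h : famIdeal k P ≤ q) : ∃ F, P F ∧ faceIdeal k F ≤ q := by
  classical
  have : (Finset.univ.filter P).inf (faceIdeal k) ≤ q := by
    refine le_trans ?_ h
    simp [famIdeal, Finset.inf_eq_iInf]
  obtain ⟨F, hF, hFq⟩ := (Ideal.IsPrime.inf_le' hq).mp this
  exact ⟨F, by simpa using hF, hFq⟩

lemma sub_le_height_of_famIdeal_le {d : ℕ} {P : Finset V → Prop} (hP : ∀ F, P F → F.card = d)
    {q : Ideal (MvPolynomial V k)} (hq : q.IsPrime) (h : famIdeal k P ≤ q) :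
    ((Fintype.card V - d : ℕ) : ℕ∞) ≤ q.height := by
  obtain ⟨F, hF, hFq⟩ := exists_faceIdeal_le hq h
  have := (card_compl_le_height_faceIdeal (k := k) F).trans (Ideal.height_mono hFq)
  rwa [Finset.card_compl, hP F hF] at this

end Height

/-! ### Strongly connected complexes and glueing of polynomials along facets -/

/-- Two `d`-element faces containing `τ` are linked if they share at least `d - 1` vertices. -/
def FaceStep {V : Type*} [DecidableEq V] (Δ : Set (Finset V)) (τ : Finset V) (d : ℕ)
    (A B : Finset V) : Prop :=
  A ∈ Δ ∧ B ∈ Δ ∧ A.card = d ∧ B.card = d ∧ τ ⊆ A ∧ τ ⊆ B ∧ d ≤ (A ∩ B).card + 1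

/-- For all `τ` and `d`, the `d`-element faces containing `τ` are connected through faces of
codimension one containing `τ`. -/
def SkeletaStronglyConnected {V : Type*} [DecidableEq V] (Δ : Set (Finset V)) : Prop :=
  ∀ (τ : Finset V) (d : ℕ) (A B : Finset V), A ∈ Δ → B ∈ Δ → A.card = d → B.card = d →
    τ ⊆ A → τ ⊆ B → Relation.ReflTransGen (FaceStep Δ τ d) A B

section Glue

lemma exists_facet_superset {V : Type*} [Fintype V] {Δ : Set (Finset V)} {F : Finset V}
    (hF : F ∈ Δ) : ∃ E, IsFacet Δ E ∧ F ⊆ E := by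
  classical
  obtain ⟨E, hFE, hE⟩ := (Set.toFinite Δ).exists_le_maximal hF
  exact ⟨E, ⟨hE.prop, fun G hG h => le_antisymm h (hE.le_of_ge hG h)⟩, hFE⟩

lemma exists_facet_ssuperset {V : Type*} [Fintype V] {Δ : Set (Finset V)} {F : Finset V}
    (hF : F ∈ Δ) (hnF : ¬ IsFacet Δ F) :
    ∃ E, IsFacet Δ E ∧ F ⊆ E ∧ F.card < E.card := by
  obtain ⟨E, hE, hFE⟩ := exists_facet_superset hF
  refine ⟨E, hE, hFE, Finset.card_lt_card (lt_of_le_of_ne hFE ?_)⟩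
  rintro rfl
  exact hnF hE

variable {k : Type*} [Field k] {V : Type*} [DecidableEq V] [Fintype V] {Δ : Set (Finset V)}

lemma coeff_eq_or_eq_zero_of_chain {d : ℕ} {n : Finset V → MvPolynomial V k}
    (h1 : ∀ F F', IsFacet Δ F → IsFacet Δ F' → F.card = d → F'.card = d →
      d ≤ (F ∩ F').card + 1 → proj k (F ∩ F') (n F) = proj k (F ∩ F') (n F'))
    (h2 : ∀ F E, IsFacet Δ F → IsFacet Δ E → F.card = d → d < E.card →
      d ≤ (F ∩ E).card + 1 → proj k (F ∩ E) (n F) = 0)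
    {a : V →₀ ℕ} {F G : Finset V} (hF : IsFacet Δ F)
    (hFG : Relation.ReflTransGen (FaceStep Δ a.support d) F G) :
    (IsFacet Δ G ∧ coeff a (n F) = coeff a (n G)) ∨
      (coeff a (n F) = 0 ∧ ∃ E, IsFacet Δ E ∧ d < E.card ∧ a.support ⊆ E) := by
  induction hFG with
  | refl => exact Or.inl ⟨hF, rfl⟩
  | @tail X Y _ hXY ih =>
    obtain ⟨hX, hY, hXc, hYc, haX, haY, hc⟩ := hXY
    rcases ih with ⟨hXf, he⟩ | ih
    · by_cases hYf : IsFacet Δ Y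
      · left
        refine ⟨hYf, he.trans ?_⟩
        have := congrArg (coeff a) (h1 X Y hXf hYf hXc hYc hc)
        rwa [coeff_proj, coeff_proj, if_pos (Finset.subset_inter haX haY),
          if_pos (Finset.subset_inter haX haY)] at this
      · right
        obtain ⟨E, hE, hYE, hlt⟩ := exists_facet_ssuperset hY hYf
        have hsub : X ∩ Y ⊆ X ∩ E := Finset.inter_subset_inter_left hYE
        have := congrArg (coeff a) (h2 X E hXf hE hXc (hYc ▸ hlt)
          (hc.trans (Nat.succ_le_succ (Finset.card_le_card hsub))))
        rw [coeff_proj, if_pos (Finset.subset_inter haX (haY.trans hYE)), coeff_zero] at this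
        exact ⟨he.trans this, E, hE, hYc ▸ hlt, haY.trans hYE⟩
    · exact Or.inr ih

lemma exists_glue (hconv : IsComplex Δ) (hΔ : SkeletaStronglyConnected Δ) {d : ℕ}
    (n : Finset V → MvPolynomial V k)
    (h1 : ∀ F F', IsFacet Δ F → IsFacet Δ F' → F.card = d → F'.card = d →
      d ≤ (F ∩ F').card + 1 → proj k (F ∩ F') (n F) = proj k (F ∩ F') (n F'))
    (h2 : ∀ F E, IsFacet Δ F → IsFacet Δ E → F.card = d → d < E.card →
      d ≤ (F ∩ E).card + 1 → proj k (F ∩ E) (n F) = 0) :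
    ∃ g : MvPolynomial V k, (∀ F, IsFacet Δ F → F.card = d → proj k F g = proj k F (n F)) ∧
      ∀ E, IsFacet Δ E → d < E.card → proj k E g = 0 := by
  classical
  have hbig : ∀ (a : V →₀ ℕ) (F E : Finset V), IsFacet Δ F → F.card = d → a.support ⊆ F →
      IsFacet Δ E → d < E.card → a.support ⊆ E → coeff a (n F) = 0 := by
    intro a F E hF hFc haF hE hEc haE
    obtain ⟨G, haG, hGE, hGc⟩ := Finset.exists_subsuperset_card_eq haE
      ((Finset.card_le_card haF).trans hFc.le) hEc.le
    have hchain := hΔ a.support d F G hF.1 (hconv E hE.1 G hGE) hFc hGc haF haG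
    rcases coeff_eq_or_eq_zero_of_chain h1 h2 hF hchain with ⟨hG, -⟩ | ⟨h0, -⟩
    · have := hG.2 E hE.1 hGE
      subst this; omega
    · exact h0
  have hsame : ∀ (a : V →₀ ℕ) (F F' : Finset V), IsFacet Δ F → F.card = d → a.support ⊆ F →
      IsFacet Δ F' → F'.card = d → a.support ⊆ F' →
      (¬ ∃ E, IsFacet Δ E ∧ d < E.card ∧ a.support ⊆ E) → coeff a (n F) = coeff a (n F') := by
    intro a F F' hF hFc haF hF' hFc' haF' hno
    have hchain := hΔ a.support d F F' hF.1 hF'.1 hFc hFc' haF haF'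
    rcases coeff_eq_or_eq_zero_of_chain h1 h2 hF hchain with ⟨-, h⟩ | ⟨-, h⟩
    · exact h
    · exact absurd h hno
  let c : (V →₀ ℕ) → k := fun a =>
    if ∃ E, IsFacet Δ E ∧ d < E.card ∧ a.support ⊆ E then 0
    else if h : ∃ F, IsFacet Δ F ∧ F.card = d ∧ a.support ⊆ F then coeff a (n h.choose) else 0
  let S : Finset (V →₀ ℕ) := Finset.univ.biUnion fun F => (n F).support
  let g : MvPolynomial V k := ∑ a ∈ S, monomial a (c a)
  have hg : ∀ a, coeff a g = c a := by
    intro a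
    have : coeff a g = if a ∈ S then c a else 0 := by
      simp only [g, coeff_sum, coeff_monomial]
      rw [Finset.sum_ite_eq']
    rw [this]
    split_ifs with haS
    · rfl
    · simp only [S, Finset.mem_biUnion, Finset.mem_univ, true_and, not_exists,
        mem_support_iff, not_not] at haS
      simp only [c]
      split_ifs
      · rfl
      · exact (haS _).symm
      · rfl
  refine ⟨g, fun F hF hFc => ?_, fun E hE hEc => ?_⟩
  · ext a
    rw [coeff_proj, coeff_proj, hg]
    split_ifs with haF
    · simp only [c]
      split_ifs with hex hF'
      · obtain ⟨E, hE, hEc, haE⟩ := hex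
        exact (hbig a F E hF hFc haF hE hEc haE).symm
      · obtain ⟨h3, h4, h5⟩ := hF'.choose_spec
        exact hsame a _ F h3 h4 h5 hF hFc haF hex
      · exact absurd ⟨F, hF, hFc, haF⟩ hF'
    · rfl
  · ext a
    rw [coeff_proj, hg, coeff_zero]
    split_ifs with haE
    · exact if_pos ⟨E, hE, hEc, haE⟩
    · rfl

end Glue

/-! ### Avoiding primes and coprimality -/

section Avoid

lemma exists_mem_forall_notMem {R : Type*} [CommRing R] {p : Ideal R} (s : Finset (Ideal R))
    (hs : ∀ Q ∈ s, Q.IsPrime ∧ ¬ p ≤ Q) : ∃ x ∈ p, ∀ Q ∈ s, x ∉ Q := by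
  by_contra! h
  have hsub : (p : Set R) ⊆ ⋃ Q ∈ (↑s : Set (Ideal R)), (id Q : Ideal R) := by
    intro x hx
    obtain ⟨Q, hQ, hxQ⟩ := h x hx
    exact Set.mem_biUnion (by simpa using hQ) hxQ
  obtain ⟨Q, hQ, hpQ⟩ :=
    (Ideal.subset_union_prime (f := id) ⊤ ⊤ (fun Q hQ _ _ => (hs Q hQ).1)).mp hsub
  exact (hs Q hQ).2 hpQ

variable {k : Type*} [Field k] {V : Type*} [DecidableEq V]

lemma proj_eq_self_iff {F : Finset V} {f : MvPolynomial V k} :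
    proj k F f = f ↔ ∀ v ∉ F, degreeOf v f = 0 := by
  constructor
  · intro h v hv
    rw [degreeOf_eq_sup, ← bot_eq_zero, Finset.sup_eq_bot_iff]
    intro a ha
    rw [← h, mem_support_iff, coeff_proj] at ha
    have ha' : a.support ⊆ F := by by_contra h'; simp [h'] at ha
    by_contra hne
    exact hv (ha' (Finsupp.mem_support_iff.mpr hne))
  · intro h
    ext a
    rw [coeff_proj]
    split_ifs with ha
    · rfl
    · obtain ⟨v, hv, hvF⟩ := Finset.not_subset.mp ha
      by_contra hne
      have h1 := monomial_le_degreeOf v (mem_support_iff.mpr (Ne.symm hne))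
      rw [h v hvF] at h1
      exact Finsupp.mem_support_iff.mp hv (Nat.le_zero.mp h1)

lemma proj_eq_self_of_dvd {F : Finset V} {f q : MvPolynomial V k} (hf : proj k F f = f)
    (hf0 : f ≠ 0) (hq : q ∣ f) : proj k F q = q := by
  obtain ⟨r, rfl⟩ := hq
  rw [proj_eq_self_iff] at *
  intro v hv
  have := hf v hv
  rw [degreeOf_mul_eq (left_ne_zero_of_mul hf0) (right_ne_zero_of_mul hf0)] at this
  omega

lemma comap_proj_span_singleton {F : Finset V} {q : MvPolynomial V k} (hq : proj k F q = q) :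
    (Ideal.span {q}).comap (proj k F) =
      Ideal.span (insert q (X '' {v : V | v ∉ F})) := by
  apply le_antisymm
  · intro f hf
    rw [Ideal.mem_comap] at hf
    have h1 : f = proj k F f + (f - proj k F f) := by ring
    rw [h1, Ideal.span_insert]
    exact add_mem (Ideal.mem_sup_left hf) (Ideal.mem_sup_right (sub_proj_mem_span F f))
  · rw [Ideal.span_le]
    rintro _ (rfl | ⟨v, hv, rfl⟩)
    · refine Ideal.mem_comap.mpr ?_
      rw [hq]
      exact Ideal.mem_span_singleton_self _
    · refine Ideal.mem_comap.mpr ?_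
      rw [proj_X_of_notMem hv]
      exact zero_mem _

variable [Fintype V]

/-- In a prime of sufficiently large height there is an element whose projection to each of the
given coordinate subspaces is coprime to that of a given polynomial. -/
lemma exists_mem_forall_dvd_of_dvd_mul {p : Ideal (MvPolynomial V k)} {d : ℕ}
    (hp : ((Fintype.card V - d + 2 : ℕ) : ℕ∞) ≤ p.height) {x : MvPolynomial V k}
    (hx : ∀ F : Finset V, F.card = d → proj k F x ≠ 0) :
    ∃ y ∈ p, ∀ F : Finset V, F.card = d → ∀ m, proj k F x ∣ m * proj k F y →
      proj k F x ∣ m := by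
  classical
  let s : Finset (Ideal (MvPolynomial V k)) :=
    (Finset.univ.filter fun F : Finset V => F.card = d).biUnion fun F =>
      (UniqueFactorizationMonoid.factors (proj k F x)).toFinset.image
        fun q => (Ideal.span {q}).comap (proj k F)
  obtain ⟨y, hyp, hy⟩ := exists_mem_forall_notMem (p := p) s (by
    intro Q hQ
    simp only [s, Finset.mem_biUnion, Finset.mem_filter, Finset.mem_univ, true_and,
      Finset.mem_image, Multiset.mem_toFinset] at hQ
    obtain ⟨F, hF, q, hq, rfl⟩ := hQ
    have hqp : Prime q := UniqueFactorizationMonoid.prime_of_factor q hq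
    have hself : proj k F q = q := proj_eq_self_of_dvd (f := proj k F x)
      (proj_proj_of_subset subset_rfl x) (hx F hF)
      (UniqueFactorizationMonoid.dvd_of_mem_factors hq)
    have : (Ideal.span {q}).IsPrime := (Ideal.span_singleton_prime hqp.ne_zero).mpr hqp
    have hprime : ((Ideal.span {q}).comap (proj k F)).IsPrime := Ideal.comap_isPrime _ _
    refine ⟨hprime, fun hle => ?_⟩
    have h1 := height_le_of_eq_span_insert q (comap_proj_span_singleton hself)
    have h2 := (hp.trans (Ideal.height_mono hle)).trans h1
    rw [Finset.card_compl, hF] at h2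
    have h3 : Fintype.card V - d + 2 ≤ Fintype.card V - d + 1 := by exact_mod_cast h2
    omega)
  refine ⟨y, hyp, fun F hF m hm => ?_⟩
  refine UniqueFactorizationMonoid.dvd_of_dvd_mul_left_of_no_prime_factors (hx F hF) ?_ hm
  intro q hqx hqy hq
  obtain ⟨r, hr, hqr⟩ := UniqueFactorizationMonoid.exists_mem_factors_of_dvd (hx F hF)
    hq.irreducible hqx
  refine hy ((Ideal.span {r}).comap (proj k F)) ?_ ?_
  · simp only [s, Finset.mem_biUnion, Finset.mem_filter, Finset.mem_univ, true_and,
      Finset.mem_image, Multiset.mem_toFinset]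
    exact ⟨F, hF, r, hr, rfl⟩
  · rw [Ideal.mem_comap, Ideal.mem_span_singleton]
    exact hqr.symm.dvd.trans hqy

end Avoid

/-! ### The dimension filtration -/

section Filtration

variable {k : Type*} [Field k] {V : Type*} [DecidableEq V]

variable (k) in
/-- The Stanley-Reisner ideal of the subcomplex generated by the facets with at least `d`
vertices. -/
noncomputable def facetIdeal (Δ : Set (Finset V)) (d : ℕ) : Ideal (MvPolynomial V k) :=
  famIdeal k fun F => IsFacet Δ F ∧ d ≤ F.card

variable (k) in
/-- The Stanley-Reisner ideal of the subcomplex generated by the facets with exactly `d`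
vertices. -/
noncomputable def facetIdealEq (Δ : Set (Finset V)) (d : ℕ) : Ideal (MvPolynomial V k) :=
  famIdeal k fun F => IsFacet Δ F ∧ F.card = d

variable {Δ : Set (Finset V)}

lemma mem_facetIdeal_iff {d : ℕ} {f : MvPolynomial V k} :
    f ∈ facetIdeal k Δ d ↔ f ∈ facetIdeal k Δ (d + 1) ∧ f ∈ facetIdealEq k Δ d := by
  simp only [facetIdeal, facetIdealEq, mem_famIdeal]
  constructor
  · exact fun h => ⟨fun F hF => h F ⟨hF.1, by omega⟩, fun F hF => h F ⟨hF.1, hF.2.ge⟩⟩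
  · rintro ⟨h1, h2⟩ F ⟨hF, hd⟩
    rcases hd.eq_or_lt with he | hl
    · exact h2 F ⟨hF, he.symm⟩
    · exact h1 F ⟨hF, hl⟩

lemma facetIdeal_le_succ (d : ℕ) : facetIdeal k Δ d ≤ facetIdeal k Δ (d + 1) :=
  fun _ hf => (mem_facetIdeal_iff.mp hf).1

/-- The monomial of a facet `F` with `d` vertices vanishes on all larger facets. -/
lemma prod_X_mem_facetIdeal {F : Finset V} (hF : IsFacet Δ F) :
    ∏ v ∈ F, X v ∈ facetIdeal k Δ (F.card + 1) := by
  rw [facetIdeal, mem_famIdeal]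
  rintro E ⟨hE, hlt⟩
  have hsub : ¬ F ⊆ E := fun h => by
    have := hF.2 E hE.1 h
    subst this; omega
  obtain ⟨v, hv, hvE⟩ := Finset.not_subset.mp hsub
  rw [map_prod]
  exact Finset.prod_eq_zero hv (proj_X_of_notMem hvE)

lemma proj_prod_X_self (F : Finset V) :
    proj k F (∏ v ∈ F, X v) = ∏ v ∈ F, X v := by
  rw [map_prod]
  exact Finset.prod_congr rfl fun v hv => proj_X_of_mem hv

lemma prod_X_ne_zero {k V : Type*} [Field k] (F : Finset V) :
    (∏ v ∈ F, X v : MvPolynomial V k) ≠ 0 :=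
  Finset.prod_ne_zero_iff.mpr fun v _ => X_ne_zero v

lemma facetIdeal_lt_succ {F : Finset V} (hF : IsFacet Δ F) :
    facetIdeal k Δ F.card < facetIdeal k Δ (F.card + 1) := by
  refine lt_of_le_of_ne (facetIdeal_le_succ _) fun he => ?_
  have h1 := prod_X_mem_facetIdeal (k := k) hF
  rw [← he, facetIdeal, mem_famIdeal] at h1
  have := h1 F ⟨hF, le_rfl⟩
  rw [proj_prod_X_self] at this
  exact prod_X_ne_zero F this

lemma facetIdealEq_le_annihilator (d : ℕ) :
    facetIdealEq k Δ d ≤ Module.annihilator (MvPolynomial V k)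
      (subquot (facetIdeal k Δ d) (facetIdeal k Δ (d + 1))) := by
  intro r hr
  rw [Module.mem_annihilator]
  intro m
  obtain ⟨⟨m, hm⟩, rfl⟩ := Submodule.Quotient.mk_surjective _ m
  rw [← Submodule.Quotient.mk_smul, Submodule.Quotient.mk_eq_zero, Submodule.mem_comap]
  change r * m ∈ facetIdeal k Δ d
  exact mem_facetIdeal_iff.mpr ⟨Ideal.mul_mem_left _ r hm, Ideal.mul_mem_right _ _ hr⟩

lemma annihilator_le_faceIdeal {F : Finset V} (hF : IsFacet Δ F) :
    Module.annihilator (MvPolynomial V k)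
      (subquot (facetIdeal k Δ F.card) (facetIdeal k Δ (F.card + 1))) ≤ faceIdeal k F := by
  intro r hr
  rw [Module.mem_annihilator] at hr
  have h1 := hr (Submodule.Quotient.mk ⟨_, prod_X_mem_facetIdeal hF⟩)
  rw [← Submodule.Quotient.mk_smul, Submodule.Quotient.mk_eq_zero, Submodule.mem_comap] at h1
  change r * ∏ v ∈ F, X v ∈ facetIdeal k Δ F.card at h1
  rw [facetIdeal, mem_famIdeal] at h1
  have h2 := h1 F ⟨hF, le_rfl⟩
  rw [map_mul, proj_prod_X_self] at h2
  exact (mul_eq_zero.mp h2).resolve_right (prod_X_ne_zero F)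

lemma exists_ringHom_surjective_ker (F : Finset V) :
    ∃ f : MvPolynomial V k →+* MvPolynomial F k, Function.Surjective f ∧
      faceIdeal k F ≤ RingHom.ker f := by
  classical
  let f : MvPolynomial V k →ₐ[k] MvPolynomial F k :=
    aeval fun v => if h : v ∈ F then X ⟨v, h⟩ else 0
  refine ⟨f, ?_, ?_⟩
  · intro g
    refine ⟨rename (fun v : F => (v : V)) g, ?_⟩
    change f _ = g
    rw [aeval_rename]
    have : ((fun v => if h : v ∈ F then X ⟨v, h⟩ else 0) ∘ fun v : F => (v : V)) =
        (X : F → MvPolynomial F k) := by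
      ext1 v; simp
    rw [this, aeval_X_left_apply]
  · rw [faceIdeal_eq_span, Ideal.span_le]
    rintro _ ⟨v, hv, rfl⟩
    change f (X v) = 0
    rw [aeval_X, dif_neg hv]

lemma le_natCast_of_not_succ_le {n : ℕ} {D : WithBot ℕ∞} (h : ¬ ((n + 1 : ℕ) : WithBot ℕ∞) ≤ D) :
    D ≤ (n : ℕ) := by
  induction D with
  | bot => exact bot_le
  | coe D =>
    induction D with
    | top => exact absurd (WithBot.coe_le_coe.mpr le_top) h
    | coe D =>
      have h1 : ¬ n + 1 ≤ D := fun h2 => h (by exact_mod_cast h2)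
      have h2 : D ≤ n := by omega
      exact_mod_cast h2

lemma isWeaklyRegular_singleton {d : ℕ} {x : MvPolynomial V k}
    (hx : ∀ F : Finset V, F.card = d → proj k F x ≠ 0) :
    IsSMulRegular (subquot (facetIdeal k Δ d) (facetIdeal k Δ (d + 1))) x := by
  rw [isSMulRegular_quotient_iff_mem_of_smul_mem]
  rintro ⟨m, hm⟩ h
  change x * m ∈ facetIdeal k Δ d at h
  change m ∈ facetIdeal k Δ d
  rw [mem_facetIdeal_iff] at h ⊢
  refine ⟨hm, mem_famIdeal.mpr fun F hF => ?_⟩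
  have := mem_famIdeal.mp h.2 F hF
  rw [map_mul] at this
  exact (mul_eq_zero.mp this).resolve_left (hx F hF.2)

variable [Fintype V]

lemma mDim_subquot_facetIdeal {F : Finset V} (hF : IsFacet Δ F) :
    mDim (MvPolynomial V k) (subquot (facetIdeal k Δ F.card) (facetIdeal k Δ (F.card + 1))) =
      (F.card : ℕ) := by
  have hdim : ringKrullDim (MvPolynomial V k) = (Fintype.card V : ℕ) := by
    rw [MvPolynomial.ringKrullDim_of_isNoetherianRing, ringKrullDim_eq_zero_of_field]
    simp
  apply le_antisymm
  · refine le_natCast_of_not_succ_le fun hle => ?_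
    have := hle.trans (ringKrullDim_le_of_surjective
      (Ideal.Quotient.factor (facetIdealEq_le_annihilator F.card))
      (Ideal.Quotient.factor_surjective _))
    have h2 := add_le_ringKrullDim_of_le_ringKrullDim_quotient
      (fun q hq hBq => sub_le_height_of_famIdeal_le (d := F.card) (fun E hE => hE.2) hq hBq) this
    rw [hdim] at h2
    have h3 : Fintype.card V - F.card + (F.card + 1) ≤ Fintype.card V := by exact_mod_cast h2
    have := Finset.card_le_univ F
    omega
  · obtain ⟨f, hf, hker⟩ := exists_ringHom_surjective_ker (k := k) F
    have h1 := ringKrullDim_le_of_surjective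
      (Ideal.Quotient.lift _ f fun a ha => hker (annihilator_le_faceIdeal hF ha))
      (Ideal.Quotient.lift_surjective_of_surjective _ _ hf)
    refine le_trans (le_of_eq ?_) h1
    rw [MvPolynomial.ringKrullDim_of_isNoetherianRing, ringKrullDim_eq_zero_of_field]
    simp

/-! ### Serre's condition for the pieces of the filtration -/

lemma isWeaklyRegular_pair (hconv : IsComplex Δ) (hΔ : SkeletaStronglyConnected Δ)
    {d : ℕ} {x y : MvPolynomial V k}
    (hx : ∀ F : Finset V, d ≤ F.card + 1 → proj k F x ≠ 0)
    (hxy : ∀ F : Finset V, F.card = d → ∀ m, proj k F x ∣ m * proj k F y → proj k F x ∣ m) :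
    RingTheory.Sequence.IsWeaklyRegular
      (subquot (facetIdeal k Δ d) (facetIdeal k Δ (d + 1))) [x, y] := by
  rw [RingTheory.Sequence.isWeaklyRegular_cons_iff,
    RingTheory.Sequence.isWeaklyRegular_singleton_iff]
  refine ⟨isWeaklyRegular_singleton fun F hF => hx F (by omega), ?_⟩
  refine (isSMulRegular_quotient_iff_mem_of_smul_mem _ _).mpr ?_
  intro mbar h
  obtain ⟨⟨m, hm⟩, rfl⟩ := Submodule.Quotient.mk_surjective _ mbar
  rw [Submodule.mem_smul_pointwise_iff_exists] at h ⊢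
  obtain ⟨mbar', -, h⟩ := h
  obtain ⟨⟨m', hm'⟩, rfl⟩ := Submodule.Quotient.mk_surjective _ mbar'
  rw [← Submodule.Quotient.mk_smul, ← Submodule.Quotient.mk_smul, Submodule.Quotient.eq,
    Submodule.mem_comap] at h
  change x * m' - y * m ∈ facetIdeal k Δ d at h
  have h2 := mem_famIdeal.mp (mem_facetIdeal_iff.mp h).2
  have hdiv : ∀ F, IsFacet Δ F → F.card = d → proj k F x ∣ proj k F m := by
    intro F hF hFc
    have := h2 F ⟨hF, hFc⟩
    rw [map_sub, map_mul, map_mul, sub_eq_zero] at this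
    exact hxy F hFc _ ⟨proj k F m', by rw [this, mul_comm]⟩
  have hdiv' : ∀ F, ∃ n, IsFacet Δ F → F.card = d → proj k F m = proj k F x * n := by
    intro F
    by_cases h : IsFacet Δ F ∧ F.card = d
    · obtain ⟨n, hn⟩ := hdiv F h.1 h.2
      exact ⟨n, fun _ _ => hn⟩
    · exact ⟨0, fun h1 h2 => absurd ⟨h1, h2⟩ h⟩
  choose n hn using hdiv'
  have hsub : ∀ (σ F : Finset V), σ ⊆ F → IsFacet Δ F → F.card = d →
      proj k σ x * proj k σ (n F) = proj k σ m := by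
    intro σ F hσ hF hFc
    have := congrArg (proj k σ) (hn F hF hFc)
    rw [map_mul, proj_proj_of_subset hσ, proj_proj_of_subset hσ] at this
    exact this.symm
  have hm0 : ∀ E, IsFacet Δ E → d < E.card → proj k E m = 0 := fun E hE hEc =>
    mem_famIdeal.mp hm E ⟨hE, hEc⟩
  obtain ⟨g, hg1, hg2⟩ := exists_glue hconv hΔ (d := d) n
    (fun F F' hF hF' hFc hFc' hc => by
      apply mul_left_cancel₀ (hx _ hc)
      rw [hsub _ F Finset.inter_subset_left hF hFc, hsub _ F' Finset.inter_subset_right hF' hFc'])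
    (fun F E hF hE hFc hEc hc => by
      have h3 := hsub _ F (Finset.inter_subset_left (s₂ := E)) hF hFc
      rw [← proj_proj_of_subset (Finset.inter_subset_right (s₁ := F) (s₂ := E)) m,
        hm0 E hE hEc, map_zero] at h3
      exact (mul_eq_zero.mp h3).resolve_left (hx _ hc))
  have hgmem : g ∈ facetIdeal k Δ (d + 1) := mem_famIdeal.mpr fun E hE => hg2 E hE.1 hE.2
  refine ⟨Submodule.Quotient.mk ⟨g, hgmem⟩, trivial, ?_⟩
  rw [← Submodule.Quotient.mk_smul, Submodule.Quotient.eq, Submodule.mem_comap]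
  change x * g - m ∈ facetIdeal k Δ d
  refine mem_facetIdeal_iff.mpr ⟨sub_mem (Ideal.mul_mem_left _ _ hgmem) hm,
    mem_famIdeal.mpr fun F hF => ?_⟩
  rw [map_sub, map_mul, hg1 F hF.1 hF.2, hsub F F subset_rfl hF.1 hF.2, sub_self]

lemma exists_mem_forall_proj_ne_zero {p : Ideal (MvPolynomial V k)} {c : ℕ}
    (hp : ((Fintype.card V - c + 1 : ℕ) : ℕ∞) ≤ p.height) :
    ∃ x ∈ p, ∀ F : Finset V, c ≤ F.card → proj k F x ≠ 0 := by
  obtain ⟨x, hxp, hx⟩ := exists_mem_forall_notMem (p := p)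
    ((Finset.univ.filter fun F : Finset V => c ≤ F.card).image (faceIdeal k)) (by
      intro Q hQ
      simp only [Finset.mem_image, Finset.mem_filter, Finset.mem_univ, true_and] at hQ
      obtain ⟨F, hF, rfl⟩ := hQ
      refine ⟨inferInstance, fun hle => ?_⟩
      have h2 := (hp.trans (Ideal.height_mono hle)).trans (height_faceIdeal_le F)
      rw [Finset.card_compl] at h2
      have h3 : Fintype.card V - c + 1 ≤ Fintype.card V - F.card := by exact_mod_cast h2
      omega)
  exact ⟨x, hxp, fun F hF => hx _ (Finset.mem_image_of_mem _ (by simpa using hF))⟩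

lemma map_le_annihilator_localizedModule {A M : Type*} [CommRing A] [AddCommGroup M] [Module A M]
    {B : Ideal A} (hB : B ≤ Module.annihilator A M) (S : Submonoid A) :
    B.map (algebraMap A (Localization S)) ≤
      Module.annihilator (Localization S) (LocalizedModule S M) := by
  rw [Ideal.map_le_iff_le_comap]
  intro r hr
  rw [Ideal.mem_comap, Module.mem_annihilator]
  intro z
  induction z using LocalizedModule.induction_on with
  | h m s =>
    rw [algebraMap_smul, LocalizedModule.smul'_mk, Module.mem_annihilator.mp (hB hr) m,
      LocalizedModule.zero_mk]

lemma add_le_height_of_le_ringKrullDim_quotient_map {A : Type*} [CommRing A] {B : Ideal A} {N j : ℕ}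
    (hB : ∀ q : Ideal A, q.IsPrime → B ≤ q → (N : ℕ∞) ≤ q.height) (p : Ideal A) [p.IsPrime]
    (hj : (j : WithBot ℕ∞) ≤ ringKrullDim
      (Localization p.primeCompl ⧸ B.map (algebraMap A (Localization p.primeCompl)))) :
    ((N + j : ℕ) : ℕ∞) ≤ p.height := by
  have h2 := add_le_ringKrullDim_of_le_ringKrullDim_quotient (N := N) (by
    intro q hq hBq
    rw [← IsLocalization.height_under p.primeCompl q]
    exact hB _ (Ideal.comap_isPrime _ _) (Ideal.map_le_iff_le_comap.mp hBq)) hj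
  rw [IsLocalization.AtPrime.ringKrullDim_eq_height p (Localization p.primeCompl)] at h2
  exact_mod_cast h2

/-- The height of `p` is at least the codimension of `Δ` plus the local dimension at `p`. -/
lemma add_le_height_of_le_mDim_localizedModule {d : ℕ} (p : Ideal (MvPolynomial V k)) [p.IsPrime]
    {j : ℕ} (hj : (j : WithBot ℕ∞) ≤ mDim (Localization p.primeCompl) (LocalizedModule p.primeCompl
      (subquot (facetIdeal k Δ d) (facetIdeal k Δ (d + 1))))) :
    ((Fintype.card V - d + j : ℕ) : ℕ∞) ≤ p.height := by
  have hle := map_le_annihilator_localizedModule (facetIdealEq_le_annihilator (k := k) (Δ := Δ) d)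
    p.primeCompl
  exact add_le_height_of_le_ringKrullDim_quotient_map
    (fun q hq hBq => sub_le_height_of_famIdeal_le (fun F hF => hF.2) hq hBq) p
    (hj.trans (ringKrullDim_le_of_surjective (Ideal.Quotient.factor hle)
      (Ideal.Quotient.factor_surjective _)))

lemma nontrivial_of_mDim_ne_bot {A M : Type*} [CommRing A] [AddCommGroup M] [Module A M]
    (h : mDim A M ≠ ⊥) : Nontrivial M := by
  by_contra hM
  rw [not_nontrivial_iff_subsingleton] at hM
  apply h
  rw [mDim, Module.annihilator_eq_top_iff.mpr hM]
  have : Subsingleton (A ⧸ (⊤ : Ideal A)) := Ideal.Quotient.subsingleton_iff.mpr rfl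
  exact ringKrullDim_eq_bot_of_subsingleton

lemma length_le_depthIn {A M : Type*} [CommRing A] [AddCommGroup M] [Module A M]
    [IsNoetherianRing A] [Module.Finite A M] (p : Ideal A) [p.IsPrime]
    [Nontrivial (LocalizedModule p.primeCompl M)] {rs : List A}
    (hrs : RingTheory.Sequence.IsWeaklyRegular M rs) (hmem : ∀ r ∈ rs, r ∈ p) :
    (rs.length : ℕ∞) ≤ depthIn (Localization p.primeCompl)
          (Ideal.map (algebraMap A (Localization p.primeCompl)) p)
          (LocalizedModule p.primeCompl M) := by
  refine le_sSup ⟨rs.map (algebraMap A (Localization p.primeCompl)), ?_, ?_, by simp⟩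
  · intro x hx
    obtain ⟨r, hr, rfl⟩ := List.mem_map.mp hx
    exact Ideal.mem_map_of_mem _ (hmem r hr)
  · have : IsLocalizedModule.AtPrime p (LocalizedModule.mkLinearMap p.primeCompl M) :=
      inferInstanceAs (IsLocalizedModule p.primeCompl _)
    have : Module.Finite (Localization p.primeCompl) (LocalizedModule p.primeCompl M) :=
      Module.Finite.of_isLocalizedModule p.primeCompl (LocalizedModule.mkLinearMap p.primeCompl M)
    exact hrs.isRegular_of_isLocalizedModule_of_mem (Localization p.primeCompl) p
      (LocalizedModule.mkLinearMap p.primeCompl M) hmem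

lemma isSerreMod_two_subquot_facetIdeal (hconv : IsComplex Δ) (hΔ : SkeletaStronglyConnected Δ)
    {d : ℕ} (hd : d ≤ Fintype.card V) :
    IsSerreMod 2 (MvPolynomial V k)
      (subquot (facetIdeal k Δ d) (facetIdeal k Δ (d + 1))) := by
  intro p hp
  set D := mDim (Localization p.primeCompl) (LocalizedModule p.primeCompl
      (subquot (facetIdeal k Δ d) (facetIdeal k Δ (d + 1)))) with hD
  have hnt : ∀ j : ℕ, (j : WithBot ℕ∞) ≤ D → Nontrivial (LocalizedModule p.primeCompl
      (subquot (facetIdeal k Δ d) (facetIdeal k Δ (d + 1)))) := fun j hj =>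
    nontrivial_of_mDim_ne_bot (A := Localization p.primeCompl) fun hbot => by
      rw [← hD] at hbot
      rw [hbot] at hj
      exact absurd hj (by simp)
  by_cases h2 : ((2 : ℕ) : WithBot ℕ∞) ≤ D
  · have hht := add_le_height_of_le_mDim_localizedModule p h2
    have := hnt 2 h2
    obtain ⟨x, hxp, hx⟩ := exists_mem_forall_proj_ne_zero (c := d - 1) (le_trans (by
      exact_mod_cast (by omega : Fintype.card V - (d - 1) + 1 ≤ Fintype.card V - d + 2)) hht)
    obtain ⟨y, hyp, hy⟩ := exists_mem_forall_dvd_of_dvd_mul hht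
      (fun F hF => hx F (by omega))
    have h3 := length_le_depthIn p (isWeaklyRegular_pair hconv hΔ
      (fun F hF => hx F (by omega)) hy) (by simp [hxp, hyp])
    refine (min_le_left _ _).trans ?_
    exact_mod_cast h3
  by_cases h1 : ((1 : ℕ) : WithBot ℕ∞) ≤ D
  · have hht := add_le_height_of_le_mDim_localizedModule p h1
    have := hnt 1 h1
    obtain ⟨x, hxp, hx⟩ := exists_mem_forall_proj_ne_zero (c := d) hht
    have h3 := length_le_depthIn p ((RingTheory.Sequence.isWeaklyRegular_singleton_iff _ _).mpr
      (isWeaklyRegular_singleton (Δ := Δ) fun F hF => hx F hF.ge)) (by simp [hxp])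
    have hD1 : D ≤ ((1 : ℕ) : WithBot ℕ∞) := le_natCast_of_not_succ_le h2
    refine (min_le_right _ _).trans (hD1.trans ?_)
    exact_mod_cast h3
  · have hD0 : D ≤ ((0 : ℕ) : WithBot ℕ∞) := le_natCast_of_not_succ_le h1
    refine (min_le_right _ _).trans (hD0.trans ?_)
    exact_mod_cast bot_le

end Filtration

section Assembly

variable {k : Type*} [Field k] {V : Type*} [DecidableEq V] [Fintype V] {Δ : Set (Finset V)}

lemma srIdeal_eq_famIdeal (hconv : IsComplex Δ) : srIdeal k Δ = famIdeal k (IsFacet Δ) := by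
  apply le_antisymm
  · rw [srIdeal, Ideal.span_le]
    rintro _ ⟨F, hF, rfl⟩
    rw [SetLike.mem_coe, mem_famIdeal]
    intro E hE
    obtain ⟨v, hv, hvE⟩ := Finset.not_subset.mp fun h : F ⊆ E => hF (hconv E hE.1 F h)
    rw [map_prod]
    exact Finset.prod_eq_zero hv (proj_X_of_notMem hvE)
  · intro f hf
    rw [mem_famIdeal_iff_coeff] at hf
    rw [f.as_sum]
    refine Ideal.sum_mem _ fun a ha => ?_
    have hnot : a.support ∉ Δ := fun hmem => by
      obtain ⟨F, hF, hsub⟩ := exists_facet_superset hmem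
      exact mem_support_iff.mp ha (hf F hF a hsub)
    refine Ideal.mem_of_dvd _ ?_ (Ideal.subset_span ⟨a.support, hnot, rfl⟩)
    rw [monomial_eq]
    exact Dvd.dvd.mul_left (Finset.prod_dvd_prod_of_dvd _ _ fun v hv =>
      dvd_pow_self _ (Finsupp.mem_support_iff.mp hv)) _

/-- A complex whose skeleta are strongly connected is sequentially `S_2`. -/
theorem isSeqSerre_two_of_skeletaStronglyConnected (hconv : IsComplex Δ)
    (hΔ : SkeletaStronglyConnected Δ) : IsSeqSerre k Δ 2 := by
  classical
  let p : ℕ → Prop := fun n => ∃ F, IsFacet Δ F ∧ F.card = n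
  have hp_le : ∀ n, p n → n ≤ Fintype.card V := by
    rintro _ ⟨F, -, rfl⟩
    exact Finset.card_le_univ F
  have hfin : (Set.ofPred p).Finite := (Set.finite_Iic (Fintype.card V)).subset hp_le
  let t := hfin.toFinset.card
  let J : ℕ → Ideal (MvPolynomial V k) := fun i =>
    famIdeal k fun F => IsFacet Δ F ∧ i ≤ Nat.count p F.card
  have hnth : ∀ i < t, p (Nat.nth p i) := fun i hi => Nat.nth_mem i fun _ => hi
  have hcount : ∀ i < t, Nat.count p (Nat.nth p i) = i := fun i hi =>
    Nat.count_nth fun _ => hi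
  have hlt : ∀ n, p n → Nat.count p n < t := fun n hn => by
    exact Nat.count_lt_card hfin hn
  have hJ : ∀ i < t, J i = facetIdeal k Δ (Nat.nth p i) := by
    intro i hi
    refine congrArg (famIdeal k) (funext fun F => propext (and_congr_right fun hF => ?_))
    constructor
    · intro h
      by_contra! hlt'
      have := Nat.count_strict_mono (p := p) ⟨F, hF, rfl⟩ hlt'
      rw [hcount i hi] at this
      omega
    · intro h
      have := Nat.count_monotone p h
      rwa [hcount i hi] at this
  have hJ' : ∀ i < t, J (i + 1) = facetIdeal k Δ (Nat.nth p i + 1) := by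
    intro i hi
    refine congrArg (famIdeal k) (funext fun F => propext (and_congr_right fun hF => ?_))
    constructor
    · intro h
      by_contra! hlt'
      have := Nat.count_monotone p (Nat.le_of_lt_succ hlt')
      rw [hcount i hi] at this
      omega
    · intro h
      have := Nat.count_strict_mono (hnth i hi) h
      rwa [hcount i hi] at this
  have hdim : ∀ i < t, mDim (MvPolynomial V k) (subquot (J i) (J (i + 1))) = Nat.nth p i := by
    intro i hi
    obtain ⟨F, hF, hFc⟩ := hnth i hi
    rw [hJ i hi, hJ' i hi, ← hFc]
    exact mDim_subquot_facetIdeal hF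
  refine ⟨t, J, ?_, ?_, fun i _ => isHomogeneousIdeal_famIdeal _, ?_, ?_, ?_⟩
  · rw [srIdeal_eq_famIdeal hconv]
    exact congrArg (famIdeal k) (funext fun F => by simp)
  · rw [eq_top_iff]
    intro f _
    refine mem_famIdeal.mpr fun F hF => ?_
    exact absurd (hlt _ ⟨F, hF.1, rfl⟩) (not_lt.mpr hF.2)
  · intro i hi
    obtain ⟨F, hF, hFc⟩ := hnth i hi
    rw [hJ i hi, hJ' i hi, ← hFc]
    exact facetIdeal_lt_succ hF
  · intro i hi
    rw [hJ i hi, hJ' i hi]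
    exact isSerreMod_two_subquot_facetIdeal hconv hΔ (hp_le _ (hnth i hi))
  · intro i hi
    rw [hdim i (by omega), hdim (i + 1) (by omega)]
    have : Nat.nth p i < Nat.nth p (i + 1) :=
      Nat.nth_lt_nth' (Nat.lt_succ_self i) fun _ => hi
    exact_mod_cast this

end Assembly

/-! ### Graphs -/

section Graphs

variable {W : Type*} {H : SimpleGraph W}

/-- A closed walk of length `m ≥ 3` through the distinct vertices `f 0, …, f (m - 1)` of `C`. -/
def IsCycleIn (H : SimpleGraph W) (C : Set W) (m : ℕ) (f : ℕ → W) : Prop :=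
  3 ≤ m ∧ (∀ i < m, ∀ j < m, f i = f j → i = j) ∧ (∀ i, i + 1 < m → H.Adj (f i) (f (i + 1))) ∧
    H.Adj (f (m - 1)) (f 0) ∧ ∀ i < m, f i ∈ C

lemma exists_isCycleIn [Finite W] {C : Set W} (hne : C.Nonempty)
    (hC : ∀ u ∈ C, ∃ v ∈ C, ∃ w ∈ C, v ≠ w ∧ H.Adj u v ∧ H.Adj u w) :
    ∃ m f, IsCycleIn H C m f := by
  classical
  have hnext : ∀ x y, ∃ z, y ∈ C → z ∈ C ∧ H.Adj y z ∧ z ≠ x := by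
    intro x y
    by_cases hy : y ∈ C
    · obtain ⟨v, hv, w, hw, hvw, hyv, hyw⟩ := hC y hy
      by_cases hvx : v = x
      · exact ⟨w, fun _ => ⟨hw, hyw, fun h => hvw (hvx.trans h.symm)⟩⟩
      · exact ⟨v, fun _ => ⟨hv, hyv, hvx⟩⟩
    · exact ⟨x, fun h => absurd h hy⟩
  choose next hnext using hnext
  obtain ⟨a, ha⟩ := hne
  let s : ℕ → W × W := fun n => Nat.rec (a, a) (fun _ q => (q.2, next q.1 q.2)) n
  let f : ℕ → W := fun n => (s n).2
  have hf : ∀ n, f n ∈ C := by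
    intro n
    induction n with
    | zero => exact ha
    | succ n ih => exact (hnext (s n).1 (f n) ih).1
  have hadj : ∀ n, H.Adj (f n) (f (n + 1)) := fun n => (hnext (s n).1 (f n) (hf n)).2.1
  have hback : ∀ n, f (n + 2) ≠ f n := fun n => (hnext (f n) (f (n + 1)) (hf (n + 1))).2.2
  have hrep : ∃ j, ∃ i < j, f i = f j := by
    obtain ⟨i, j, hij, he⟩ := Finite.exists_ne_map_eq_of_infinite f
    rcases hij.lt_or_gt with h | h
    · exact ⟨j, i, h, he⟩
    · exact ⟨i, j, h, he.symm⟩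
  obtain ⟨i, hij, he⟩ := Nat.find_spec hrep
  have hmin : ∀ q < Nat.find hrep, ∀ r < q, f r ≠ f q := fun q hq r hr h =>
    Nat.find_min hrep hq ⟨r, hr, h⟩
  generalize Nat.find hrep = j at hij he hmin
  have h3 : i + 3 ≤ j := by
    by_contra! hlt
    rcases (by omega : j = i + 1 ∨ j = i + 2) with rfl | rfl
    · exact (hadj i).ne he
    · exact hback i he.symm
  refine ⟨j - i, fun n => f (i + n), by omega, ?_, fun n _ => hadj _, ?_, fun n _ => hf _⟩
  · intro q hq r hr h
    by_contra hqr
    rcases Nat.lt_or_gt_of_ne hqr with hlt | hlt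
    · exact hmin (i + r) (by omega) (i + q) (by omega) h
    · exact hmin (i + q) (by omega) (i + r) (by omega) h.symm
  · have := hadj (j - 1)
    rw [show j - 1 + 1 = j by omega, ← he] at this
    change H.Adj (f (i + (j - i - 1))) (f i)
    rwa [show i + (j - i - 1) = j - 1 by omega]

lemma IsCycleIn.chordless_of_minimal {C : Set W} {m : ℕ} {f : ℕ → W} (hf : IsCycleIn H C m f)
    (hmin : ∀ n < m, ∀ g, ¬ IsCycleIn H C n g) {i j : ℕ} (hij : i < j) (hj : j < m) :
    H.Adj (f i) (f j) ↔ j = i + 1 ∨ (i = 0 ∧ j + 1 = m) := by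
  obtain ⟨h3, hinj, hadj, hlast, hC⟩ := hf
  constructor
  · intro h
    by_contra! hcon
    refine hmin (j - i + 1) (by omega) (fun n => f (i + n))
      ⟨by omega, fun q hq r hr he => ?_, fun n hn => hadj _ (by omega), ?_,
        fun n hn => hC _ (by omega)⟩
    · have := hinj _ (by omega) _ (by omega) he
      omega
    · change H.Adj (f (i + (j - i + 1 - 1))) (f i)
      rw [show i + (j - i + 1 - 1) = j by omega]
      exact h.symm
  · rintro (rfl | ⟨rfl, rfl⟩)
    · exact hadj _ hj
    · exact hlast.symm

lemma hasChordlessCycle_of_forall_lt {m : ℕ} {f : ℕ → W} (h3 : 3 ≤ m)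
    (hinj : ∀ i < m, ∀ j < m, f i = f j → i = j)
    (hadj : ∀ i j, i < j → j < m → (H.Adj (f i) (f j) ↔ j = i + 1 ∨ (i = 0 ∧ j + 1 = m))) :
    HasChordlessCycle H m := by
  refine ⟨h3, ?_⟩
  obtain ⟨n, rfl⟩ : ∃ n, m = n + 1 := ⟨m - 1, by omega⟩
  change ∃ f : Fin (n + 1) → W, Function.Injective f ∧
    ∀ i j : Fin (n + 1), H.Adj (f i) (f j) ↔ (j = i + 1 ∨ i = j + 1)
  refine ⟨fun i => f i, fun i j h => Fin.ext (hinj _ i.2 _ j.2 h), fun i j => ?_⟩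
  have hi := i.2
  have hj := j.2
  simp only [Fin.ext_iff, Fin.val_add_one, Fin.val_last]
  rcases lt_trichotomy (i : ℕ) j with h | h | h
  · rw [hadj _ _ h hj]
    split_ifs <;> omega
  · rw [h]
    simp only [SimpleGraph.irrefl, false_iff]
    split_ifs <;> omega
  · rw [H.adj_comm, hadj _ _ h hi]
    split_ifs <;> omega

/-- Two independent sets such that every vertex has at least two neighbours in one of them. -/
structure IsDominatingPair (H : SimpleGraph W) (A B : Set W) : Prop where
  left : ∀ x ∈ A, ∀ y ∈ A, ¬ H.Adj x y
  right : ∀ x ∈ B, ∀ y ∈ B, ¬ H.Adj x y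
  exists_adj : ∀ u, (∃ v ∈ A, ∃ w ∈ A, v ≠ w ∧ H.Adj u v ∧ H.Adj u w) ∨
    ∃ v ∈ B, ∃ w ∈ B, v ≠ w ∧ H.Adj u v ∧ H.Adj u w

namespace IsDominatingPair

variable {A B : Set W}

lemma symm (h : IsDominatingPair H A B) : IsDominatingPair H B A :=
  ⟨h.right, h.left, fun u => (h.exists_adj u).symm⟩

lemma notMem_right (h : IsDominatingPair H A B) {x : W} (hA : x ∈ A) : x ∉ B := fun hB => by
  obtain ⟨v, hv, -, -, -, hxv, -⟩ | ⟨v, hv, -, -, -, hxv, -⟩ := h.exists_adj x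
  · exact h.left x hA v hv hxv
  · exact h.right x hB v hv hxv

lemma exists_even_chordlessCycle [Finite W] (h : IsDominatingPair H A B) (hne : A.Nonempty) :
    ∃ m, Even m ∧ HasChordlessCycle H m := by
  classical
  have hcyc : ∃ m f, IsCycleIn H (A ∪ B) m f := by
    refine exists_isCycleIn (hne.mono Set.subset_union_left) fun u _ => ?_
    obtain ⟨v, hv, w, hw, hvw⟩ | ⟨v, hv, w, hw, hvw⟩ := h.exists_adj u
    · exact ⟨v, Or.inl hv, w, Or.inl hw, hvw⟩
    · exact ⟨v, Or.inr hv, w, Or.inr hw, hvw⟩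
  obtain ⟨f, hf⟩ := Nat.find_spec hcyc
  have hmin : ∀ n < Nat.find hcyc, ∀ g, ¬ IsCycleIn H (A ∪ B) n g := fun n hn g hg =>
    Nat.find_min hcyc hn ⟨g, hg⟩
  generalize Nat.find hcyc = m at hf hmin
  refine ⟨m, ?_, hasChordlessCycle_of_forall_lt hf.1 hf.2.1 fun i j => hf.chordless_of_minimal hmin⟩
  obtain ⟨h3, -, hadj, hlast, hC⟩ := hf
  have halt : ∀ x ∈ A ∪ B, ∀ y ∈ A ∪ B, H.Adj x y → (x ∈ A ↔ y ∉ A) := by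
    intro x hx y hy hxy
    refine ⟨fun hxA hyA => h.left x hxA y hyA hxy, fun hyA => ?_⟩
    by_contra hxA
    exact h.right x (hx.resolve_left hxA) y (hy.resolve_left hyA) hxy
  have hpar : ∀ i < m, (f i ∈ A ↔ (f 0 ∈ A ↔ Even i)) := by
    intro i hi
    induction i with
    | zero => simp
    | succ i ih =>
      have h1 := ih (by omega)
      have h2 := halt _ (hC i (by omega)) _ (hC _ hi) (hadj i hi)
      rw [Nat.even_add_one]
      tauto
  have h1 := hpar (m - 1) (by omega)
  have h2 := halt _ (hC (m - 1) (by omega)) _ (hC 0 (by omega)) hlast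
  have h4 : ¬ Even (m - 1) := by tauto
  rw [show m = m - 1 + 1 by omega, Nat.even_add_one]
  exact h4

lemma not_hasSimplicialVertex (h : IsDominatingPair H A B) : ¬ HasSimplicialVertex H := by
  rintro ⟨z, hz⟩
  obtain ⟨v, hv, w, hw, hvw, h1, h2⟩ | ⟨v, hv, w, hw, hvw, h1, h2⟩ := h.exists_adj z
  · exact h.left v hv w hw (hz v w h1 h2 hvw)
  · exact h.right v hv w hw (hz v w h1 h2 hvw)

lemma notMem_of_path (h : IsDominatingPair H A B) {t : ℕ} {g : ℕ → W}
    (hnb : ∀ s < t, ∀ u, H.Adj (g (2 * s + 1)) u → u = g (2 * s + 2) ∨ u = g (2 * s))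
    (hclose : H.Adj (g (2 * t)) (g 0)) : g 0 ∉ A := by
  intro h0
  have key : ∀ s ≤ t, g (2 * s) ∈ A := by
    intro s hs
    induction s with
    | zero => exact h0
    | succ s ih =>
      have hs' := ih (by omega)
      have hboth : ∀ X : Set W, (∃ v ∈ X, ∃ w ∈ X, v ≠ w ∧ H.Adj (g (2 * s + 1)) v ∧
          H.Adj (g (2 * s + 1)) w) → g (2 * s + 2) ∈ X ∧ g (2 * s) ∈ X := by
        rintro X ⟨v, hv, w, hw, hvw, h1, h2⟩
        rcases hnb s (by omega) v h1 with rfl | rfl <;>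
          rcases hnb s (by omega) w h2 with rfl | rfl
        · exact absurd rfl hvw
        · exact ⟨hv, hw⟩
        · exact ⟨hw, hv⟩
        · exact absurd rfl hvw
      rcases h.exists_adj (g (2 * s + 1)) with hA | hB
      · exact (hboth A hA).1
      · exact absurd (hboth B hB).2 (h.notMem_right hs')
  exact h.left _ (key t le_rfl) _ h0 hclose

end IsDominatingPair

/-- A set of `t` pairwise non-consecutive residues modulo `2t + 1` is of the form
`e + 1, e + 3, …, e + 2t - 1`. -/
lemma exists_forall_add_mem {t : ℕ} (T : Finset (ZMod (2 * t + 1))) (hT : T.card = t)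
    (hsep : ∀ i ∈ T, i + 1 ∉ T) :
    ∃ e, ∀ s < t, e + ((2 * s + 1 : ℕ) : ZMod (2 * t + 1)) ∈ T := by
  classical
  let T' := T.image (· + 1)
  have hdisj : Disjoint T T' := by
    rw [Finset.disjoint_left]
    intro i hi hi'
    obtain ⟨j, hj, rfl⟩ := Finset.mem_image.mp hi'
    exact hsep j hj hi
  have hcard : (T ∪ T')ᶜ.card = 1 := by
    rw [Finset.card_compl, Finset.card_union_of_disjoint hdisj,
      Finset.card_image_of_injective _ (add_left_injective 1), hT, ZMod.card]
    omega
  obtain ⟨e, he⟩ := Finset.card_eq_one.mp hcard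
  have he_mem : e ∉ T := fun hmem => by
    have : e ∈ (T ∪ T')ᶜ := by rw [he]; exact Finset.mem_singleton_self e
    exact Finset.mem_compl.mp this (Finset.mem_union_left _ hmem)
  have hnext : ∀ x, x + 1 ≠ e → x ∉ T → x + 1 ∈ T := by
    intro x hx hxT
    have h1 : x + 1 ∈ T ∪ T' := by
      by_contra hcon
      rw [← Finset.mem_compl, he, Finset.mem_singleton] at hcon
      exact hx hcon
    rcases Finset.mem_union.mp h1 with h | h
    · exact h
    · obtain ⟨j, hj, hjx⟩ := Finset.mem_image.mp h
      rw [add_left_injective 1 hjx] at hj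
      exact absurd hj hxT
  have hne : ∀ n, 0 < n → n < 2 * t + 1 → e + ((n : ℕ) : ZMod (2 * t + 1)) ≠ e := by
    intro n h0 hn h
    rw [add_eq_left, ZMod.natCast_eq_zero_iff] at h
    exact absurd (Nat.le_of_dvd h0 h) (by omega)
  refine ⟨e, fun s hs => ?_⟩
  induction s with
  | zero =>
    have := hnext e (by simpa using hne 1 one_pos (by omega)) he_mem
    simpa using this
  | succ s ih =>
    have h1 := hsep _ (ih (by omega))
    have h2 : e + ((2 * s + 1 : ℕ) : ZMod (2 * t + 1)) + 1 + 1 =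
        e + ((2 * (s + 1) + 1 : ℕ) : ZMod (2 * t + 1)) := by
      push_cast; ring
    have h3 := hnext _ (by rw [h2]; exact hne _ (by omega) (by omega)) h1
    rwa [h2] at h3

lemma IsDominatingPair.not_hasGoodOddCycle {A B : Set W} (h : IsDominatingPair H A B) :
    ¬ HasGoodOddCycle H := by
  rintro ⟨t, ht, f, hinj, hadj, T, hTc, hT, hdeg⟩
  obtain ⟨e, he⟩ := exists_forall_add_mem T hTc fun i hi hi' => by
    have h1 : H.Adj (f i) (f (i + 1)) := (hadj _ _).mpr (Or.inl rfl)
    exact hT i hi _ hi' (fun heq => h1.ne (congrArg f heq)) h1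
  let g : ℕ → W := fun n => f (e + (n : ZMod (2 * t + 1)))
  have hnb : ∀ s < t, ∀ u, H.Adj (g (2 * s + 1)) u → u = g (2 * s + 2) ∨ u = g (2 * s) := by
    intro s hs u hu
    refine (hdeg _ (he s hs) u hu).imp (fun h => h.trans (congrArg f ?_))
      fun h => h.trans (congrArg f ?_)
    · push_cast; ring
    · push_cast; ring
  have hclose : H.Adj (g (2 * t)) (g 0) := by
    refine (hadj _ _).mpr (Or.inl ?_)
    have : ((2 * t + 1 : ℕ) : ZMod (2 * t + 1)) = 0 := ZMod.natCast_self _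
    rw [Nat.cast_zero, add_assoc, ← Nat.cast_succ, this]
  have h0A := h.notMem_of_path hnb hclose
  have h0B := h.symm.notMem_of_path hnb hclose
  have hboth : ∀ X : Set W, (∃ v ∈ X, ∃ w ∈ X, v ≠ w ∧ H.Adj (g 1) v ∧ H.Adj (g 1) w) →
      g 0 ∈ X := by
    rintro X ⟨v, hv, w, hw, hvw, h1, h2⟩
    rcases hnb 0 (by omega) v h1 with rfl | rfl
    · rcases hnb 0 (by omega) w h2 with rfl | rfl
      · exact absurd rfl hvw
      · exact hw
    · exact hv
  rcases h.exists_adj (g 1) with hA | hB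
  · exact h0A (hboth A hA)
  · exact h0B (hboth B hB)

end Graphs

/-! ### Strong connectivity of skeleta of independence complexes -/

section IndepComplex

variable {V : Type*} [DecidableEq V]

lemma FaceStep.symm {Δ : Set (Finset V)} {τ : Finset V} {d : ℕ} {A B : Finset V}
    (h : FaceStep Δ τ d A B) : FaceStep Δ τ d B A := by
  obtain ⟨h1, h2, h3, h4, h5, h6, h7⟩ := h
  exact ⟨h2, h1, h4, h3, h6, h5, by rwa [Finset.inter_comm]⟩

lemma FaceStep.anti {Δ : Set (Finset V)} {τ σ : Finset V} (hτ : τ ⊆ σ) {d : ℕ} {A B : Finset V}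
    (h : FaceStep Δ σ d A B) : FaceStep Δ τ d A B := by
  obtain ⟨h1, h2, h3, h4, h5, h6, h7⟩ := h
  exact ⟨h1, h2, h3, h4, hτ.trans h5, hτ.trans h6, h7⟩

variable {G : SimpleGraph V}

lemma isComplex_indepComplex {V : Type*} {G : SimpleGraph V} : IsComplex (indepComplex G) :=
  fun _ hF _ hE x hx y hy => hF x (hE hx) y (hE hy)

/-- A vertex with at most one neighbour in `A` can be exchanged into `A`. -/
lemma exists_faceStep_mem {τ A : Finset V} (hA : A ∈ indepComplex G) (hτ : τ ⊆ A)
    (hcard : τ.card < A.card) {u : V} (hu : ∀ x ∈ τ, ¬ G.Adj x u)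
    (h : ∀ v ∈ A, ∀ w ∈ A, G.Adj u v → G.Adj u w → v = w) :
    ∃ A', FaceStep (indepComplex G) τ A.card A A' ∧ u ∈ A' := by
  by_cases huA : u ∈ A
  · exact ⟨A, ⟨hA, hA, rfl, rfl, hτ, hτ, by rw [Finset.inter_self]; omega⟩, huA⟩
  obtain ⟨w, hwA, hwτ, hw⟩ : ∃ w ∈ A, w ∉ τ ∧ ∀ v ∈ A, G.Adj u v → v = w := by
    by_cases hex : ∃ w ∈ A, G.Adj u w
    · obtain ⟨w, hwA, huw⟩ := hex
      exact ⟨w, hwA, fun hwτ => hu w hwτ huw.symm, fun v hv huv => h v hv w hwA huv huw⟩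
    · obtain ⟨w, hwA, hwτ⟩ := Finset.exists_mem_notMem_of_card_lt_card hcard
      exact ⟨w, hwA, hwτ, fun v hv huv => absurd ⟨v, hv, huv⟩ hex⟩
  have hsub : ∀ x ∈ A.erase w, ¬ G.Adj u x := fun x hx hux =>
    (Finset.mem_erase.mp hx).1 (hw x (Finset.mem_erase.mp hx).2 hux)
  have huE : u ∉ A.erase w := fun hmem => huA (Finset.mem_of_mem_erase hmem)
  have hE : (A.erase w).card + 1 = A.card := Finset.card_erase_add_one hwA
  refine ⟨insert u (A.erase w), ⟨hA, ?_, rfl, ?_, hτ, ?_, ?_⟩, Finset.mem_insert_self _ _⟩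
  · intro x hx y hy hxy
    rcases Finset.mem_insert.mp hx with rfl | hxE <;> rcases Finset.mem_insert.mp hy with rfl | hyE
    · exact G.irrefl hxy
    · exact hsub y hyE hxy
    · exact hsub x hxE hxy.symm
    · exact hA x (Finset.mem_of_mem_erase hxE) y (Finset.mem_of_mem_erase hyE) hxy
  · rw [Finset.card_insert_of_notMem huE, hE]
  · intro x hx
    exact Finset.mem_insert_of_mem (Finset.mem_erase.mpr ⟨fun h => hwτ (h ▸ hx), hτ hx⟩)
  · rw [← hE]
    refine Nat.succ_le_succ (Finset.card_le_card fun x hx => ?_)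
    exact Finset.mem_inter.mpr ⟨Finset.mem_of_mem_erase hx, Finset.mem_insert_of_mem hx⟩

/-- If the skeleta of all larger links are connected, two faces that are not connected
form a dominating pair. -/
lemma isDominatingPair_of_not_reflTransGen {τ A B : Finset V} {d : ℕ}
    (hconn : ∀ u ∉ τ, ∀ A B : Finset V, A ∈ indepComplex G → B ∈ indepComplex G → A.card = d →
      B.card = d → insert u τ ⊆ A → insert u τ ⊆ B →
        Relation.ReflTransGen (FaceStep (indepComplex G) (insert u τ) d) A B)
    (hA : A ∈ indepComplex G) (hB : B ∈ indepComplex G) (hAd : A.card = d) (hBd : B.card = d)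
    (hτA : τ ⊆ A) (hτB : τ ⊆ B) (hd : τ.card < d)
    (hAB : ¬ Relation.ReflTransGen (FaceStep (indepComplex G) τ d) A B) :
    IsDominatingPair (G.induce {v : V | v ∉ τ ∧ ∀ u ∈ τ, ¬ G.Adj u v})
      {v | (v : V) ∈ A} {v | (v : V) ∈ B} := by
  refine ⟨fun x hx y hy => hA x hx y hy, fun x hx y hy => hB x hx y hy, fun u => ?_⟩
  have hlift : ∀ X ∈ indepComplex G, τ ⊆ X → X.card = d →
      ¬ (∃ v ∈ {v : {v : V | v ∉ τ ∧ ∀ u ∈ τ, ¬ G.Adj u v} | (v : V) ∈ X},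
        ∃ w ∈ {v : {v : V | v ∉ τ ∧ ∀ u ∈ τ, ¬ G.Adj u v} | (v : V) ∈ X}, v ≠ w ∧
        (G.induce {v : V | v ∉ τ ∧ ∀ u ∈ τ, ¬ G.Adj u v}).Adj u v ∧
        (G.induce {v : V | v ∉ τ ∧ ∀ u ∈ τ, ¬ G.Adj u v}).Adj u w) →
      ∃ X', FaceStep (indepComplex G) τ d X X' ∧ (u : V) ∈ X' := by
    rintro X hX hτX rfl hno
    refine exists_faceStep_mem hX hτX hd u.2.2 fun v hv w hw huv huw => ?_
    by_contra hvw
    have hmem : ∀ x ∈ X, G.Adj u x → x ∉ τ ∧ ∀ u ∈ τ, ¬ G.Adj u x := fun x hx hux =>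
      ⟨fun hxτ => u.2.2 x hxτ hux.symm, fun y hy => hX y (hτX hy) x hx⟩
    exact hno ⟨⟨v, hmem v hv huv⟩, hv, ⟨w, hmem w hw huw⟩, hw,
      fun h => hvw (congrArg Subtype.val h), huv, huw⟩
  by_contra hcon
  rw [not_or] at hcon
  obtain ⟨A', hAA', huA'⟩ := hlift A hA hτA hAd hcon.1
  obtain ⟨B', hBB', huB'⟩ := hlift B hB hτB hBd hcon.2
  refine hAB (.trans (.head hAA' ?_) (.single hBB'.symm))
  obtain ⟨-, hA', -, hA'd, -, hτA', -⟩ := hAA'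
  obtain ⟨-, hB', -, hB'd, -, hτB', -⟩ := hBB'
  exact Relation.ReflTransGen.mono (fun _ _ hs => hs.anti (Finset.subset_insert _ _))
    _ _ (hconn u u.2.1 A' B' hA' hB' hA'd hB'd (Finset.insert_subset huA' hτA')
      (Finset.insert_subset huB' hτB'))

lemma skeletaStronglyConnected_indepComplex [Finite V]
    (h : ∀ F : Finset V, F ∈ indepComplex G → ¬ IsFacet (indepComplex G) F →
      (∀ m : ℕ, Even m →
          ¬ HasChordlessCycle (G.induce {v : V | v ∉ F ∧ ∀ u ∈ F, ¬ G.Adj u v}) m) ∨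
      HasSimplicialVertex (G.induce {v : V | v ∉ F ∧ ∀ u ∈ F, ¬ G.Adj u v}) ∨
      HasGoodOddCycle (G.induce {v : V | v ∉ F ∧ ∀ u ∈ F, ¬ G.Adj u v})) :
    SkeletaStronglyConnected (indepComplex G) := by
  intro τ d
  induction hn : d - τ.card generalizing τ with
  | zero =>
    intro A B hA hB hAd hBd hτA hτB
    exact .single ⟨hA, hB, hAd, hBd, hτA, hτB, by
      have := Finset.card_le_card (Finset.subset_inter hτA hτB)
      omega⟩
  | succ n ih =>
    intro A B hA hB hAd hBd hτA hτB
    have hd : τ.card < d := by omega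
    by_contra hAB
    have hdom := isDominatingPair_of_not_reflTransGen (fun u hu => ih (insert u τ) (by
      rw [Finset.card_insert_of_notMem hu]; omega)) hA hB hAd hBd hτA hτB hd hAB
    rcases h τ (isComplex_indepComplex A hA τ hτA) (fun hfac => by
      rw [hfac.2 A hA hτA] at hd
      omega) with h1 | h1 | h1
    · obtain ⟨a, haA, haτ⟩ := Finset.exists_mem_notMem_of_card_lt_card (hd.trans_eq hAd.symm)
      obtain ⟨m, hm, hcyc⟩ := hdom.exists_even_chordlessCycle
        ⟨⟨a, haτ, fun y hy => hA y (hτA hy) a haA⟩, haA⟩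
      exact h1 m hm hcyc
    · exact hdom.not_hasSimplicialVertex h1
    · exact hdom.not_hasGoodOddCycle h1

end IndepComplex

/-- **A sufficient local condition for sequentially `S_2`.**
Let `G = (V, E)` be a finite simple graph.  Suppose that for every independent set
`F` of `G` that is not a maximal independent set (including `F = ∅`), the induced
subgraph `H = G ∖ N_G[F]` satisfies at least one of: (i) `H` has no chordless even
cycle; (ii) `H` has a simplicial vertex; (iii) for some `t ≥ 2`, `H` contains a
chordless `(2t+1)`-cycle having `t` vertices which are independent in `H` and each
of degree `2` in `H`.  Then `G` is sequentially `S_2` over any field `k`. -/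
theorem isSeqSerre_two_of_local_condition (k : Type*) [Field k]
    (V : Type*) [Fintype V] [DecidableEq V] (G : SimpleGraph V)
    (h : ∀ F : Finset V, F ∈ indepComplex G → ¬ IsFacet (indepComplex G) F →
      (∀ m : ℕ, Even m →
          ¬ HasChordlessCycle (G.induce {v : V | v ∉ F ∧ ∀ u ∈ F, ¬ G.Adj u v}) m) ∨
      HasSimplicialVertex (G.induce {v : V | v ∉ F ∧ ∀ u ∈ F, ¬ G.Adj u v}) ∨
      HasGoodOddCycle (G.induce {v : V | v ∉ F ∧ ∀ u ∈ F, ¬ G.Adj u v})) :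
    IsSeqSerre k (indepComplex G) 2 := by
  exact isSeqSerre_two_of_skeletaStronglyConnected isComplex_indepComplex
    (skeletaStronglyConnected_indepComplex h)

end SeqSr
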